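/- arXiv:2111.04855 — 9 statements merged into one kernel-verified Lean document; each statement's English description precedes it below -/
import Mathlib

section
/- Let ε > 0, let W : (−ε, 1) → ℝ be continuously differentiable with W′(0) > 0, and let r ∈ ℝ. Then there exists δ > 0 such that U_r(0) < U_r(u) for all u with 0 < |u| < δ, and U_r′(u) ≠ 0 for all u with 0 < |u| < δ; that is, u = 0 is a strict local minimum of U_r and U_r has no other critical points near 0, for every value of r. -/
/-- The function `v(u) = (1 - √(1-u²))/u` for `u ≠ 0`, `v(0) = 0`. -/
noncomputable def v (u : ℝ) : ℝ := if u = 0 then 0 else (1 - Real.sqrt (1 - u ^ 2)) / u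

/-- The effective potential `U_r(u) = (r²/2) v(u)² + W(u²)`. -/
noncomputable def effU (r : ℝ) (W : ℝ → ℝ) (u : ℝ) : ℝ := r ^ 2 / 2 * (v u) ^ 2 + W (u ^ 2)

theorem v_sq {u : ℝ} (hu : |u| < 1) : v u ^ 2 = 2 / (1 + √(1 - u ^ 2)) - 1 := by
  have hs : √(1 - u ^ 2) ^ 2 = 1 - u ^ 2 :=
    Real.sq_sqrt (by linarith [(sq_lt_one_iff_abs_lt_one u).2 hu])
  have h0 := Real.sqrt_nonneg (1 - u ^ 2)
  rcases eq_or_ne u 0 with rfl | hne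
  · norm_num [v]
  · have h1 : 1 + √(1 - u ^ 2) ≠ 0 := by positivity
    rw [v, if_neg hne, div_pow, div_sub_one h1, div_eq_div_iff (pow_ne_zero 2 hne) h1]
    linear_combination (√(1 - u ^ 2) - 1) * hs

theorem effU_eq (r : ℝ) (W : ℝ → ℝ) {u : ℝ} (hu : |u| < 1) :
    effU r W u = r ^ 2 / 2 * (2 / (1 + √(1 - u ^ 2)) - 1) + W (u ^ 2) := by
  rw [effU, v_sq hu]

theorem hasDerivAt_two_div_one_add_sqrt {x : ℝ} (hx : x < 1) :
    HasDerivAt (fun y : ℝ => 2 / (1 + √(1 - y)) - 1)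
      (1 / (√(1 - x) * (1 + √(1 - x)) ^ 2)) x := by
  have hs : 0 < √(1 - x) := Real.sqrt_pos.2 (by linarith)
  have h1 : HasDerivAt (fun y : ℝ => 1 + √(1 - y)) (-1 / (2 * √(1 - x))) x :=
    (((hasDerivAt_id x).const_sub 1).sqrt (sub_pos.2 hx).ne').const_add 1
  refine (((hasDerivAt_const x (2 : ℝ)).div h1 (by positivity)).sub_const 1).congr_deriv ?_
  field_simp
  ring

theorem hasDerivAt_effU (r : ℝ) {W : ℝ → ℝ} {u : ℝ} (hu : |u| < 1)
    (hW : DifferentiableAt ℝ W (u ^ 2)) :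
    HasDerivAt (effU r W)
      ((r ^ 2 / 2 * (1 / (√(1 - u ^ 2) * (1 + √(1 - u ^ 2)) ^ 2)) + deriv W (u ^ 2)) *
        (2 * u)) u := by
  have hF := ((hasDerivAt_two_div_one_add_sqrt ((sq_lt_one_iff_abs_lt_one u).2 hu)).const_mul
    (r ^ 2 / 2)).add hW.hasDerivAt
  have hsq : HasDerivAt (fun y : ℝ => y ^ 2) (2 * u) u := by
    simpa using hasDerivAt_pow 2 u
  refine (HasDerivAt.comp (h := fun y : ℝ => y ^ 2) u hF hsq).congr_of_eventuallyEq ?_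
  filter_upwards [continuous_abs.continuousAt.eventually_lt continuousAt_const hu] with y hy
  exact effU_eq r W hy

/-- If `W` is `C¹` with `W'(0) > 0` then for every `r`, `u = 0` is a strict local minimum
of `U_r`, and `U_r` has no other critical points near `0`. -/
theorem effU_strict_min_of_deriv_pos (ε : ℝ) (hε : 0 < ε) (W : ℝ → ℝ)
    (hW : ContDiffOn ℝ 1 W (Set.Ioo (-ε) 1)) (hW' : 0 < deriv W 0) (r : ℝ) :
    ∃ δ > 0, (∀ u : ℝ, 0 < |u| → |u| < δ → effU r W 0 < effU r W u) ∧
      ∀ u : ℝ, 0 < |u| → |u| < δ → deriv (effU r W) u ≠ 0 := by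
  have hmem : Set.Ioo (-ε) 1 ∈ nhds (0 : ℝ) := Ioo_mem_nhds (by linarith) one_pos
  have hpos : ∀ᶠ x in nhds (0 : ℝ), 0 < deriv W x :=
    ((hW.continuousOn_deriv_of_isOpen isOpen_Ioo le_rfl).continuousAt hmem).eventually
      (lt_mem_nhds hW')
  obtain ⟨δ, hδ, hball⟩ := Metric.eventually_nhds_iff.1 (hpos.and hmem)
  have hsmall : ∀ x, 0 ≤ x → x < δ → 0 < deriv W x ∧ x < 1 ∧ DifferentiableAt ℝ W x := by
    intro x hx0 hxδ
    obtain ⟨hd, hx⟩ := hball (y := x) (by rwa [Real.dist_eq, sub_zero, abs_of_nonneg hx0])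
    exact ⟨hd, hx.2, (hW.differentiableOn one_ne_zero).differentiableAt (isOpen_Ioo.mem_nhds hx)⟩
  have hsq : ∀ u : ℝ, |u| < δ → |u| < 1 ∧ u ^ 2 < δ := by
    intro u hu
    have h1 := (hsmall |u| (abs_nonneg u) hu).2.1
    refine ⟨h1, ?_⟩
    rw [← sq_abs]
    nlinarith [abs_nonneg u]
  have hmono : StrictMonoOn W (Set.Ico 0 δ) := by
    refine strictMonoOn_of_deriv_pos (convex_Ico 0 δ)
      (fun x hx => (hsmall x hx.1 hx.2).2.2.continuousAt.continuousWithinAt) ?_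
    intro x hx
    rw [interior_Ico] at hx
    exact (hsmall x hx.1.le hx.2).1
  refine ⟨δ, hδ, fun u hu0 hu => ?_, fun u hu0 hu => ?_⟩
  · have hu2 : 0 < u ^ 2 := sq_pos_of_ne_zero (abs_pos.1 hu0)
    have hlt := hmono ⟨le_rfl, hδ⟩ ⟨hu2.le, (hsq u hu).2⟩ hu2
    have h0 : effU r W 0 = W 0 := by simp [effU, v]
    rw [h0, effU]
    exact lt_add_of_nonneg_of_lt (by positivity) hlt
  · obtain ⟨hu1, hu2⟩ := hsq u hu
    obtain ⟨hd, -, hdiff⟩ := hsmall (u ^ 2) (sq_nonneg u) hu2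
    rw [(hasDerivAt_effU r hu1 hdiff).deriv]
    have hne : u ≠ 0 := abs_pos.1 hu0
    exact mul_ne_zero (by positivity) (mul_ne_zero two_ne_zero hne)
end

section
/- Let ε > 0, let W : (−ε, 1) → ℝ be continuously differentiable with W′(0) < 0, and set r₀ = √(−8·W′(0)). Then for every r > r₀ the point u = 0 is a strict local minimum of U_r: there exists δ > 0 with U_r(0) < U_r(u) for all 0 < |u| < δ. -/
/-- The quadratic lower bound `u²/4 ≤ v(u)²` on `[-1, 1]`. -/
theorem sq_div_four_le_v_sq {u : ℝ} (hu : u ^ 2 ≤ 1) : u ^ 2 / 4 ≤ v u ^ 2 := by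
  by_cases h0 : u = 0
  · simp [h0, v]
  have hu2 : 0 < u ^ 2 := by positivity
  rw [v, if_neg h0, div_pow, le_div_iff₀ hu2]
  set s := Real.sqrt (1 - u ^ 2)
  have hs0 : 0 ≤ s := Real.sqrt_nonneg _
  have hs : s ^ 2 = 1 - u ^ 2 := Real.sq_sqrt (by linarith)
  have hs1 : s ≤ 1 := by nlinarith
  have hus : u ^ 2 = 1 - s ^ 2 := by linarith
  rw [hus]
  nlinarith [mul_nonneg (sq_nonneg (1 - s)) (mul_nonneg (sub_nonneg.2 hs1) (by linarith : 0 ≤ 3 + s))]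

/-- If `W` is `C¹` with `W'(0) < 0` and `r > r₀ = √(-8 W'(0))`, then `u = 0` is a strict
local minimum of `U_r`. -/
theorem effU_strict_min_of_fast_spin (ε : ℝ) (hε : 0 < ε) (W : ℝ → ℝ)
    (hW : ContDiffOn ℝ 1 W (Set.Ioo (-ε) 1)) (hW' : deriv W 0 < 0)
    (r : ℝ) (hr : Real.sqrt (-8 * deriv W 0) < r) :
    ∃ δ > 0, ∀ u : ℝ, 0 < |u| → |u| < δ → effU r W 0 < effU r W u := by
  have hd : HasDerivAt W (deriv W 0) 0 :=
    ((hW.contDiffAt (Ioo_mem_nhds (by linarith) one_pos)).differentiableAt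
      one_ne_zero).hasDerivAt
  have hr2 : -8 * deriv W 0 < r ^ 2 := Real.lt_sq_of_sqrt_lt hr
  set c := (r ^ 2 / 8 + deriv W 0) / 2 with hc
  have hc0 : 0 < c := by linarith
  obtain ⟨η, hη, hball⟩ := Metric.eventually_nhds_iff.1 (hd.isLittleO.def hc0)
  refine ⟨min 1 (Real.sqrt η), by positivity, fun u hu0 hu => ?_⟩
  have hu2 : 0 < u ^ 2 := by have := abs_pos.1 hu0; positivity
  have hu1 : u ^ 2 ≤ 1 := (sq_le_one_iff_abs_le_one u).2 (hu.trans_le (min_le_left _ _)).le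
  have huη : u ^ 2 < η := by
    rw [← sq_abs]
    exact (Real.lt_sqrt (abs_nonneg u)).1 (hu.trans_le (min_le_right _ _))
  have hb := hball (y := u ^ 2) (by simpa [Real.dist_eq] using huη)
  simp only [sub_zero, smul_eq_mul, Real.norm_eq_abs, abs_of_pos hu2] at hb
  have hlow := (abs_le.1 hb).1
  have hv := mul_le_mul_of_nonneg_left (sq_div_four_le_v_sq hu1) (by positivity : 0 ≤ r ^ 2 / 2)
  have h0 : effU r W 0 = W 0 := by simp [effU, v]
  rw [h0, effU]
  have hcu : 0 < c * u ^ 2 := mul_pos hc0 hu2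
  have hsplit : r ^ 2 / 2 * (u ^ 2 / 4) + u ^ 2 * deriv W 0 = 2 * (c * u ^ 2) := by
    rw [hc]; ring
  linarith
end

section
/- Let ε > 0, let W : (−ε, 1) → ℝ be continuously differentiable with W′(0) < 0, and set r₀ = √(−8·W′(0)). Then for every r with 0 ≤ r < r₀ the point u = 0 is a strict local maximum of U_r: there exists δ > 0 with U_r(u) < U_r(0) for all 0 < |u| < δ. -/
/-- Rationalised form of `v(u)²`, regular at `u = 0`. -/
lemma v_sq_eq {u : ℝ} (hu : u ^ 2 ≤ 1) :
    v u ^ 2 = u ^ 2 * (1 / (1 + Real.sqrt (1 - u ^ 2)) ^ 2) := by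
  unfold v
  split_ifs with h
  · simp [h]
  · have hs := Real.sq_sqrt (sub_nonneg.mpr hu)
    have hs0 := Real.sqrt_nonneg (1 - u ^ 2)
    set s := Real.sqrt (1 - u ^ 2)
    have hne : 1 + s ≠ 0 := by positivity
    have hu2 : u ^ 2 = (1 - s) * (1 + s) := by linarith
    rw [div_pow, mul_one_div, div_eq_div_iff (by positivity) (by positivity), ← mul_pow, ← hu2]
    ring

/-- If `W` is `C¹` with `W'(0) < 0` and `0 ≤ r < r₀ = √(-8 W'(0))`, then `u = 0` is a strict
local maximum of `U_r`. -/
theorem effU_strict_max_of_slow_spin (ε : ℝ) (hε : 0 < ε) (W : ℝ → ℝ)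
    (hW : ContDiffOn ℝ 1 W (Set.Ioo (-ε) 1)) (hW' : deriv W 0 < 0)
    (r : ℝ) (hr0 : 0 ≤ r) (hr : r < Real.sqrt (-8 * deriv W 0)) :
    ∃ δ > 0, ∀ u : ℝ, 0 < |u| → |u| < δ → effU r W u < effU r W 0 := by
  have hWd : HasDerivAt W (deriv W 0) 0 :=
    ((hW.contDiffAt (Ioo_mem_nhds (by linarith) one_pos)).differentiableAt one_ne_zero).hasDerivAt
  have hr2 : r ^ 2 < -8 * deriv W 0 := (Real.lt_sqrt hr0).mp hr
  have hg : Filter.Tendsto (fun t : ℝ => r ^ 2 / 2 * (1 / (1 + Real.sqrt (1 - t)) ^ 2))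
      (nhdsWithin 0 {0}ᶜ) (nhds (r ^ 2 / 8)) := by
    have hc : ContinuousAt (fun t : ℝ => r ^ 2 / 2 * (1 / (1 + Real.sqrt (1 - t)) ^ 2)) 0 := by
      fun_prop (disch := positivity)
    have hval : r ^ 2 / 2 * (1 / (1 + Real.sqrt (1 - 0)) ^ 2) = r ^ 2 / 8 := by
      norm_num
      ring
    exact hval ▸ hc.tendsto.mono_left nhdsWithin_le_nhds
  have hneg := (hg.add (hasDerivAt_iff_tendsto_slope.mp hWd)).eventually_lt_const
    (show r ^ 2 / 8 + deriv W 0 < 0 by linarith)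
  obtain ⟨η, hη, hball⟩ := Metric.eventually_nhds_iff.mp (eventually_nhdsWithin_iff.mp hneg)
  refine ⟨min 1 η, lt_min one_pos hη, fun u hu0 hu => ?_⟩
  obtain ⟨hu1, huη⟩ := lt_min_iff.mp hu
  have hle : u ^ 2 ≤ |u| := by
    rw [← sq_abs]
    nlinarith
  have hpos : 0 < u ^ 2 := pow_pos hu0 2 |>.trans_eq (sq_abs u)
  have key := hball (y := u ^ 2)
    (by rw [Real.dist_eq, sub_zero, abs_of_pos hpos]; linarith) hpos.ne'
  have hmul := mul_neg_of_pos_of_neg hpos key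
  rw [slope_def_field, sub_zero, mul_add, mul_div_cancel₀ _ hpos.ne'] at hmul
  have hzero : effU r W 0 = W 0 := by simp [effU, v]
  rw [hzero, effU, v_sq_eq (hle.trans hu1.le)]
  linarith
end

section
/- Let ε > 0 and let W : (−ε, 1) → ℝ be continuously differentiable. Then for every r ∈ ℝ the effective potential U_r is twice differentiable at 0, with U_r′(0) = 0 and U_r″(0) = r²/4 + 2·W′(0). -/
theorem v_eq_div_one_add_sqrt {u : ℝ} (hu : u ^ 2 ≤ 1) :
    v u = u / (1 + Real.sqrt (1 - u ^ 2)) := by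
  unfold v
  split_ifs with h
  · simp [h]
  · have hs := Real.sq_sqrt (sub_nonneg.2 hu)
    have hpos : 1 + Real.sqrt (1 - u ^ 2) ≠ 0 := by positivity
    rw [div_eq_div_iff h hpos]
    linear_combination -hs

theorem contDiffAt_div_one_add_sqrt_sq {n : WithTop ℕ∞} :
    ContDiffAt ℝ n (fun t : ℝ => t / (1 + Real.sqrt (1 - t)) ^ 2) 0 :=
  contDiffAt_id.div
    ((contDiffAt_const.add ((contDiffAt_const.sub contDiffAt_id).sqrt (by simp))).pow 2)
    (by positivity)

theorem hasDerivAt_div_one_add_sqrt_sq :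
    HasDerivAt (fun t : ℝ => t / (1 + Real.sqrt (1 - t)) ^ 2) (1 / 4) 0 := by
  have h : HasDerivAt (fun t : ℝ => Real.sqrt (1 - t)) (-1 / (2 * Real.sqrt (1 - 0))) 0 :=
    ((hasDerivAt_id (0 : ℝ)).const_sub 1).sqrt (by simp)
  have hne : (1 + Real.sqrt (1 - 0)) ^ 2 ≠ 0 := by norm_num
  refine ((hasDerivAt_id' (0 : ℝ)).fun_div ((h.const_add 1).fun_pow 2) hne).congr_deriv ?_
  norm_num

/-- Multiplying by the identity a function continuous at `0` gives one differentiable at `0`. -/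
theorem ContinuousAt.hasDerivAt_id_mul_zero {g : ℝ → ℝ} (hg : ContinuousAt g 0) :
    HasDerivAt (fun u => u * g u) (g 0) 0 := by
  rw [hasDerivAt_iff_tendsto_slope]
  refine (hg.tendsto.mono_left nhdsWithin_le_nhds).congr' ?_
  filter_upwards [self_mem_nhdsWithin] with u hu
  have hu0 : u ≠ 0 := hu
  simp [slope_def_field, hu0]

theorem DifferentiableAt.hasDerivAt_comp_sq {F : ℝ → ℝ} {u : ℝ}
    (hF : DifferentiableAt ℝ F (u ^ 2)) :
    HasDerivAt (fun u => F (u ^ 2)) (u * (2 * deriv F (u ^ 2))) u := by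
  have h := hF.hasDerivAt.comp (h := fun u : ℝ => u ^ 2) u (hasDerivAt_pow 2 u)
  refine h.congr_deriv ?_
  push_cast
  ring

theorem hasDerivAt_comp_sq_zero {F : ℝ → ℝ} (hF : ContDiffAt ℝ 1 F 0) :
    HasDerivAt (fun u => F (u ^ 2)) 0 0 := by
  have h : DifferentiableAt ℝ F ((0 : ℝ) ^ 2) := by
    simpa using hF.differentiableAt one_ne_zero
  simpa using h.hasDerivAt_comp_sq

theorem hasDerivAt_deriv_comp_sq_zero {F : ℝ → ℝ} (hF : ContDiffAt ℝ 1 F 0) :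
    HasDerivAt (deriv fun u => F (u ^ 2)) (2 * deriv F 0) 0 := by
  have hsq : Filter.Tendsto (fun u : ℝ => u ^ 2) (nhds 0) (nhds 0) := by
    simpa using (continuous_pow 2 : Continuous fun u : ℝ => u ^ 2).tendsto 0
  have hcont : ContinuousAt (fun u : ℝ => 2 * deriv F (u ^ 2)) 0 := by
    have h : ContinuousAt (deriv F) 0 :=
      ((ContinuousLinearMap.apply ℝ ℝ (1 : ℝ)).continuous.continuousAt.comp
        (hF.continuousAt_fderiv one_ne_zero))
    have h2 := (h.tendsto.comp hsq).const_mul 2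
    simpa [ContinuousAt, Function.comp_def] using h2
  have heq : (deriv fun u => F (u ^ 2)) =ᶠ[nhds 0] fun u => u * (2 * deriv F (u ^ 2)) := by
    filter_upwards [hsq.eventually (hF.eventually (by simp))] with u hu
    exact (hu.differentiableAt one_ne_zero).hasDerivAt_comp_sq.deriv
  simpa using hcont.hasDerivAt_id_mul_zero.congr_of_eventuallyEq heq

/-- If `W` is `C¹`, then for every `r` the effective potential `U_r` is twice differentiable
at `0`, with `U_r'(0) = 0` and `U_r''(0) = r²/4 + 2 W'(0)`. -/
theorem effU_second_deriv_at_zero (ε : ℝ) (hε : 0 < ε) (W : ℝ → ℝ)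
    (hW : ContDiffOn ℝ 1 W (Set.Ioo (-ε) 1)) (r : ℝ) :
    HasDerivAt (effU r W) 0 0 ∧
    HasDerivAt (deriv (effU r W)) (r ^ 2 / 4 + 2 * deriv W 0) 0 := by
  have hWat : ContDiffAt ℝ 1 W 0 := hW.contDiffAt (Ioo_mem_nhds (by linarith) one_pos)
  have hG := contDiffAt_div_one_add_sqrt_sq (n := 1)
  have hF : ContDiffAt ℝ 1
      (fun t => r ^ 2 / 2 * (t / (1 + Real.sqrt (1 - t)) ^ 2) + W t) 0 :=
    (contDiffAt_const.mul hG).add hWat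
  have hF' : deriv (fun t => r ^ 2 / 2 * (t / (1 + Real.sqrt (1 - t)) ^ 2) + W t) 0
      = r ^ 2 / 2 * (1 / 4) + deriv W 0 :=
    ((hasDerivAt_div_one_add_sqrt_sq.const_mul _).add
      (hWat.differentiableAt one_ne_zero).hasDerivAt).deriv
  have heq : effU r W =ᶠ[nhds 0]
      fun u => r ^ 2 / 2 * (u ^ 2 / (1 + Real.sqrt (1 - u ^ 2)) ^ 2) + W (u ^ 2) := by
    filter_upwards [Ioo_mem_nhds (neg_lt_zero.2 one_pos) one_pos] with u hu
    rw [effU, v_eq_div_one_add_sqrt (by nlinarith [hu.1, hu.2]), div_pow]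
  refine ⟨(hasDerivAt_comp_sq_zero hF).congr_of_eventuallyEq heq, ?_⟩
  have h := (hasDerivAt_deriv_comp_sq_zero hF).congr_of_eventuallyEq heq.deriv
  exact h.congr_deriv (by rw [hF']; ring)
end

section
/- Fix r ∈ ℝ. For every (x, y, p_x, p_y) ∈ ℝ⁴ with x² + y² < 1 and x·p_y − y·p_x + r·√(1 − x² − y²) = r, there exist θ ∈ ℝ, u ∈ (−1,1) and p ∈ ℝ such that the simultaneous rotation by angle θ, namely R_θ(x, y, p_x, p_y) = (x cos θ − y sin θ, x sin θ + y cos θ, p_x cos θ − p_y sin θ, p_x sin θ + p_y cos θ), satisfies R_θ(x, y, p_x, p_y) = (u, 0, p, r·v(u)). -/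
/-- Every point of the plane has polar coordinates. -/
theorem exists_polar_coordinates (a b : ℝ) :
    ∃ ρ φ : ℝ, a = ρ * Real.cos φ ∧ b = ρ * Real.sin φ := by
  refine ⟨‖(⟨a, b⟩ : ℂ)‖, Complex.arg ⟨a, b⟩, ?_, ?_⟩
  · exact (Complex.norm_mul_cos_arg ⟨a, b⟩).symm
  · exact (Complex.norm_mul_sin_arg ⟨a, b⟩).symm

/-- Every point of the level set `μ_r = r` over the open unit disk can be rotated, by a
simultaneous rotation of `(x,y)` and `(p_x,p_y)`, onto a point of the slice
`(u, 0, p, r·v(u))` with `u ∈ (-1,1)`. -/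
theorem level_set_meets_slice (r x y px py : ℝ) (h1 : x ^ 2 + y ^ 2 < 1)
    (h2 : x * py - y * px + r * Real.sqrt (1 - x ^ 2 - y ^ 2) = r) :
    ∃ θ : ℝ, ∃ u ∈ Set.Ioo (-1 : ℝ) 1, ∃ p : ℝ,
      (x * Real.cos θ - y * Real.sin θ,
       x * Real.sin θ + y * Real.cos θ,
       px * Real.cos θ - py * Real.sin θ,
       px * Real.sin θ + py * Real.cos θ) = (u, 0, p, r * v u) := by
  by_cases h0 : x = 0 ∧ y = 0
  · obtain ⟨rfl, rfl⟩ := h0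
    obtain ⟨ρ, φ, rfl, rfl⟩ := exists_polar_coordinates px py
    refine ⟨-φ, 0, by norm_num, _, Prod.ext ?_ (Prod.ext ?_ (Prod.ext rfl ?_))⟩
    all_goals simp only [Real.cos_neg, Real.sin_neg, v, if_true]
    all_goals ring
  · obtain ⟨ρ, φ, rfl, rfl⟩ := exists_polar_coordinates x y
    have hρ : ρ ≠ 0 := by
      rintro rfl
      simp at h0
    have hcs := Real.sin_sq_add_cos_sq φ
    have hsq : (ρ * Real.cos φ) ^ 2 + (ρ * Real.sin φ) ^ 2 = ρ ^ 2 := by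
      linear_combination ρ ^ 2 * hcs
    rw [sub_sub, hsq] at h2
    rw [hsq] at h1
    refine ⟨-φ, ρ, abs_lt.mp ((sq_lt_one_iff_abs_lt_one ρ).mp h1), _,
      Prod.ext ?_ (Prod.ext ?_ (Prod.ext rfl ?_))⟩
    all_goals simp only [Real.cos_neg, Real.sin_neg, v, if_neg hρ]
    · linear_combination ρ * hcs
    · ring
    · field_simp
      linear_combination h2
end

section
/- Fix r ∈ ℝ. Suppose (u, p), (u′, p′) ∈ (−1,1) × ℝ and there exists θ ∈ ℝ such that the simultaneous rotation by angle θ (rotating (x,y) and (p_x,p_y) by the same angle) sends (u, 0, p, r·v(u)) to (u′, 0, p′, r·v(u′)). Then either (u′, p′) = (u, p) or (u′, p′) = (−u, −p). Consequently each diagonal SO(2)-orbit of a nonzero point of the level set meets the set {(u, 0, p, r·v(u)) : u ∈ (−1,1), p ∈ ℝ} in exactly the two points related by (u,p) ↦ (−u,−p). -/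
/-- The diagonal `SO(2)`-action on `ℝ⁴`: simultaneous rotation of `(x,y)` and `(p_x,p_y)`
by the angle `θ`. -/
noncomputable def Rot (θ : ℝ) (q : ℝ × ℝ × ℝ × ℝ) : ℝ × ℝ × ℝ × ℝ :=
  (q.1 * Real.cos θ - q.2.1 * Real.sin θ,
   q.1 * Real.sin θ + q.2.1 * Real.cos θ,
   q.2.2.1 * Real.cos θ - q.2.2.2 * Real.sin θ,
   q.2.2.1 * Real.sin θ + q.2.2.2 * Real.cos θ)

theorem v_zero : v 0 = 0 := if_pos rfl

theorem v_neg (u : ℝ) : v (-u) = -v u := by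
  by_cases hu : u = 0 <;> simp [v, hu, div_neg]

/-- A rotation preserving the slice maps `(u, p)` to `(u, p)` or to `(-u, -p)`. -/
theorem eq_or_eq_neg_of_Rot_eq {r u u' p p' θ : ℝ}
    (h : Rot θ (u, 0, p, r * v u) = (u', 0, p', r * v u')) :
    (u' = u ∧ p' = p) ∨ (u' = -u ∧ p' = -p) := by
  simp only [Rot, Prod.mk.injEq, zero_mul, sub_zero, add_zero] at h
  obtain ⟨rfl, hu, rfl, hp⟩ := h
  by_cases hs : Real.sin θ = 0
  · rcases Real.sin_eq_zero_iff_cos_eq.mp hs with hc | hc <;> simp [hs, hc]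
  · obtain rfl : u = 0 := (mul_eq_zero.mp hu).resolve_right hs
    obtain rfl : p = 0 := by simpa [v_zero, hs] using hp
    simp [v_zero]

theorem Rot_pi_slice (r u p : ℝ) :
    Rot Real.pi (u, 0, p, r * v u) = (-u, 0, -p, r * v (-u)) := by
  simp [Rot, v_neg]

theorem Rot_zero (q : ℝ × ℝ × ℝ × ℝ) : Rot 0 q = q := by
  simp [Rot]

/-- If a simultaneous rotation carries a slice point `(u, 0, p, r·v(u))` to another slice
point `(u', 0, p', r·v(u'))` then `(u',p') = (u,p)` or `(u',p') = (-u,-p)`.  Consequently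
the orbit of a nonzero slice point meets the slice in exactly the two points `(u,p)` and
`(-u,-p)`. -/
theorem slice_two_point_intersection (r : ℝ) :
    (∀ u ∈ Set.Ioo (-1 : ℝ) 1, ∀ u' ∈ Set.Ioo (-1 : ℝ) 1, ∀ p p' θ : ℝ,
      Rot θ (u, 0, p, r * v u) = (u', 0, p', r * v u') →
      (u' = u ∧ p' = p) ∨ (u' = -u ∧ p' = -p)) ∧
    (∀ u ∈ Set.Ioo (-1 : ℝ) 1, ∀ p : ℝ, (u, p) ≠ (0, 0) →
      {q : ℝ × ℝ | q.1 ∈ Set.Ioo (-1 : ℝ) 1 ∧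
          ∃ θ : ℝ, Rot θ (u, 0, p, r * v u) = (q.1, 0, q.2, r * v q.1)}
        = {(u, p), (-u, -p)} ∧ (u, p) ≠ (-u, -p)) := by
  refine ⟨fun u _ u' _ p p' θ h => eq_or_eq_neg_of_Rot_eq h, fun u hu p hne => ⟨?_, ?_⟩⟩
  · ext ⟨a, b⟩
    simp only [Set.mem_ofPred_eq, Set.mem_insert_iff, Set.mem_singleton_iff, Prod.mk.injEq]
    constructor
    · rintro ⟨_, θ, h⟩
      exact eq_or_eq_neg_of_Rot_eq h
    · rintro (⟨rfl, rfl⟩ | ⟨rfl, rfl⟩)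
      · exact ⟨hu, 0, Rot_zero _⟩
      · exact ⟨⟨neg_lt_neg hu.2, by linarith [hu.1]⟩, Real.pi, Rot_pi_slice r u p⟩
  · intro h
    rw [Prod.mk.injEq] at h
    exact hne (Prod.ext (self_eq_neg.mp h.1) (self_eq_neg.mp h.2))
end

section
/- (Lagrange top.) Define U_r : (−1,1) → ℝ by U_r(u) = (r²/2)·v(u)² + √(1 − u²). Then for every r > 2 the point u = 0 is a strict local minimum of U_r, and for every r with 0 ≤ r < 2 the point u = 0 is a strict local maximum of U_r. -/
/-- The effective potential of the Lagrange top: `U_r(u) = (r²/2) v(u)² + √(1-u²)`. -/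
noncomputable def lagU (r : ℝ) (u : ℝ) : ℝ := r ^ 2 / 2 * (v u) ^ 2 + Real.sqrt (1 - u ^ 2)

/-- Closed form of the potential: `U_r(u) = 1 + (1 - s)(r² / (2(1 + s)) - 1)`, `s = √(1-u²)`. -/
theorem lagU_eq (r : ℝ) {u : ℝ} (hu : u ≠ 0) (hu1 : |u| < 1) :
    lagU r u = 1 + (1 - √(1 - u ^ 2)) * (r ^ 2 - 2 * (1 + √(1 - u ^ 2))) /
      (2 * (1 + √(1 - u ^ 2))) := by
  have hsq : u ^ 2 < 1 := (sq_lt_one_iff_abs_lt_one u).2 hu1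
  have hs0 : 0 ≤ √(1 - u ^ 2) := Real.sqrt_nonneg _
  have hs : √(1 - u ^ 2) ^ 2 = 1 - u ^ 2 := Real.sq_sqrt (by linarith)
  unfold lagU v
  rw [if_neg hu]
  set s := √(1 - u ^ 2)
  have hv : ((1 - s) / u) ^ 2 = (1 - s) / (1 + s) := by
    rw [div_pow, div_eq_div_iff (pow_ne_zero 2 hu) (by positivity)]
    linear_combination (s - 1) * hs
  rw [hv]
  field_simp
  ring

theorem lagU_zero (r : ℝ) : lagU r 0 = 1 := by simp [lagU, v]

/-- Away from `0`, `√(1-u²)` lies strictly below `1`. -/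
theorem sqrt_one_sub_sq_lt_one {u : ℝ} (hu : u ≠ 0) : √(1 - u ^ 2) < 1 := by
  rw [Real.sqrt_lt' one_pos]
  have : 0 < u ^ 2 := by positivity
  linarith

/-- For the Lagrange top, `u = 0` is a strict local minimum of `U_r` for `r > 2` and a
strict local maximum of `U_r` for `0 ≤ r < 2`. -/
theorem lagrange_top_stability :
    (∀ r : ℝ, 2 < r →
      ∃ δ > 0, ∀ u : ℝ, 0 < |u| → |u| < δ → lagU r 0 < lagU r u) ∧
    (∀ r : ℝ, 0 ≤ r → r < 2 →
      ∃ δ > 0, ∀ u : ℝ, 0 < |u| → |u| < δ → lagU r u < lagU r 0) := by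
  refine ⟨fun r hr => ⟨1, one_pos, fun u hu0 hu => ?_⟩, fun r hr0 hr =>
    ⟨min 1 (2 - r ^ 2 / 2), lt_min one_pos (by nlinarith), fun u hu0 hu => ?_⟩⟩
  · have hne : u ≠ 0 := abs_pos.1 hu0
    have hs0 := Real.sqrt_nonneg (1 - u ^ 2)
    have hs1 := sqrt_one_sub_sq_lt_one hne
    rw [lagU_zero, lagU_eq r hne hu, lt_add_iff_pos_right]
    exact div_pos (mul_pos (by linarith) (by nlinarith)) (by linarith)
  · have hne : u ≠ 0 := abs_pos.1 hu0
    obtain ⟨hu1, hu2⟩ := lt_min_iff.1 hu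
    have hs0 := Real.sqrt_nonneg (1 - u ^ 2)
    have hs1 := sqrt_one_sub_sq_lt_one hne
    have hsq : u ^ 2 < 1 := (sq_lt_one_iff_abs_lt_one u).2 hu1
    have hs := Real.sq_sqrt (show 0 ≤ 1 - u ^ 2 by linarith)
    have hsu : 1 - u ^ 2 ≤ √(1 - u ^ 2) := by nlinarith
    have hle : u ^ 2 ≤ |u| := by nlinarith [sq_abs u]
    rw [lagU_zero, lagU_eq r hne hu1, add_lt_iff_neg_left]
    exact div_neg_of_neg_of_pos (mul_neg_of_pos_of_neg (by linarith) (by linarith)) (by linarith)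
end

section
/- (Kirchhoff top.) Let c > 0 and define U_r : (−1,1) → ℝ by U_r(u) = (r²/2)·v(u)² + c + (1 − c)·u². If c < 1, then for every r ≥ 0 the point u = 0 is a strict local minimum of U_r. If c > 1, then u = 0 is a strict local maximum of U_r for every r with 0 ≤ r < √(8(c − 1)), and a strict local minimum of U_r for every r > √(8(c − 1)). -/
/-- The effective potential of the Kirchhoff top: `U_r(u) = (r²/2) v(u)² + c + (1-c) u²`. -/
noncomputable def kirU (c r : ℝ) (u : ℝ) : ℝ := r ^ 2 / 2 * (v u) ^ 2 + c + (1 - c) * u ^ 2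

/-- The quotient `(U_r(u) - U_r(0)) / u²`, written so that it is continuous at `0`. -/
noncomputable def kirSlope (c r u : ℝ) : ℝ :=
  r ^ 2 / (2 * (1 + Real.sqrt (1 - u ^ 2)) ^ 2) + (1 - c)

lemma v_eq_div {u : ℝ} (hu : |u| < 1) : v u = u / (1 + Real.sqrt (1 - u ^ 2)) := by
  rcases eq_or_ne u 0 with rfl | hu0
  · simp [v]
  · have hs : Real.sqrt (1 - u ^ 2) ^ 2 = 1 - u ^ 2 :=
      Real.sq_sqrt (by linarith [(sq_lt_one_iff_abs_lt_one u).2 hu])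
    have hpos : 0 < 1 + Real.sqrt (1 - u ^ 2) := by positivity
    rw [v, if_neg hu0, div_eq_div_iff hu0 hpos.ne']
    linear_combination -hs

lemma kirU_eq {c r u : ℝ} (hu : |u| < 1) :
    kirU c r u = kirU c r 0 + u ^ 2 * kirSlope c r u := by
  have hpos : 0 < 1 + Real.sqrt (1 - u ^ 2) := by positivity
  have hv : v 0 = 0 := by simp [v]
  rw [kirU, kirU, kirSlope, v_eq_div hu, hv]
  field_simp
  ring

lemma continuous_kirSlope (c r : ℝ) : Continuous (kirSlope c r) := by
  unfold kirSlope
  refine (continuous_const.div (by fun_prop) fun u => ?_).add continuous_const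
  positivity

lemma kirSlope_zero (c r : ℝ) : kirSlope c r 0 = r ^ 2 / 8 + (1 - c) := by
  norm_num [kirSlope]

lemma kirU_strict_local_min {c r : ℝ} (h : 0 < r ^ 2 / 8 + (1 - c)) :
    ∃ δ > 0, ∀ u : ℝ, 0 < |u| → |u| < δ → kirU c r 0 < kirU c r u := by
  rw [← kirSlope_zero] at h
  obtain ⟨ε, hε, H⟩ := Metric.eventually_nhds_iff.1
    ((continuous_kirSlope c r).continuousAt.eventually_const_lt h)
  refine ⟨min ε 1, lt_min hε one_pos, fun u hu0 hu => ?_⟩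
  have hslope : 0 < kirSlope c r u := H (by simpa using hu.trans_le (min_le_left _ _))
  have husq : 0 < u ^ 2 := sq_pos_iff.2 (abs_pos.1 hu0)
  rw [kirU_eq (hu.trans_le (min_le_right _ _))]
  linarith [mul_pos husq hslope]

lemma kirU_strict_local_max {c r : ℝ} (h : r ^ 2 / 8 + (1 - c) < 0) :
    ∃ δ > 0, ∀ u : ℝ, 0 < |u| → |u| < δ → kirU c r u < kirU c r 0 := by
  rw [← kirSlope_zero] at h
  obtain ⟨ε, hε, H⟩ := Metric.eventually_nhds_iff.1
    ((continuous_kirSlope c r).continuousAt.eventually_lt_const h)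
  refine ⟨min ε 1, lt_min hε one_pos, fun u hu0 hu => ?_⟩
  have hslope : kirSlope c r u < 0 := H (by simpa using hu.trans_le (min_le_left _ _))
  have husq : 0 < u ^ 2 := sq_pos_iff.2 (abs_pos.1 hu0)
  rw [kirU_eq (hu.trans_le (min_le_right _ _))]
  linarith [mul_neg_of_pos_of_neg husq hslope]

/-- For the Kirchhoff top with parameter `c > 0`: if `c < 1` then `u = 0` is a strict local
minimum of `U_r` for all `r ≥ 0`; if `c > 1` then `u = 0` is a strict local maximum for
`0 ≤ r < √(8(c-1))` and a strict local minimum for `r > √(8(c-1))`. -/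
theorem kirchhoff_top_stability (c : ℝ) (hc : 0 < c) :
    (c < 1 → ∀ r : ℝ, 0 ≤ r →
      ∃ δ > 0, ∀ u : ℝ, 0 < |u| → |u| < δ → kirU c r 0 < kirU c r u) ∧
    (1 < c →
      (∀ r : ℝ, 0 ≤ r → r < Real.sqrt (8 * (c - 1)) →
        ∃ δ > 0, ∀ u : ℝ, 0 < |u| → |u| < δ → kirU c r u < kirU c r 0) ∧
      (∀ r : ℝ, Real.sqrt (8 * (c - 1)) < r →
        ∃ δ > 0, ∀ u : ℝ, 0 < |u| → |u| < δ → kirU c r 0 < kirU c r u)) := by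
  refine ⟨fun hc1 r _ => kirU_strict_local_min (by nlinarith [sq_nonneg r]), fun hc1 =>
    ⟨fun r hr0 hr => kirU_strict_local_max ?_, fun r hr => kirU_strict_local_min ?_⟩⟩
  · have := (Real.lt_sqrt hr0).1 hr
    linarith
  · have := (Real.sqrt_lt' ((Real.sqrt_nonneg _).trans_lt hr)).1 hr
    linarith
end

section
/- Let k : (−1,1) × ℝ → ℝ be a smooth function invariant under the involution (u, p) ↦ (−u, −p). Then there exist smooth functions g, h : ℝ² → ℝ, both invariant under the involution (u, p) ↦ (−u, −p), such that h(u, p) ≠ 0 for all (u, p) ∈ (−1,1) × ℝ and h(u, p)·k(u, p) = g(u, p) for all (u, p) ∈ (−1,1) × ℝ. -/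
open Function Set Metric
open scoped ContDiff

/-- All derivatives up to a given order of a smooth compactly supported function have a common
positive bound. -/
theorem exists_norm_iteratedFDeriv_le_of_hasCompactSupport {E F : Type*}
    [NormedAddCommGroup E] [NormedSpace ℝ E] [NormedAddCommGroup F] [NormedSpace ℝ F]
    {f : E → F} (hf : ContDiff ℝ ∞ f) (hc : HasCompactSupport f) (n : ℕ) :
    ∃ M : ℝ, 0 < M ∧ ∀ i ≤ n, ∀ x, ‖iteratedFDeriv ℝ i f x‖ ≤ M := by
  have bound (i : ℕ) : ∃ R, ∀ x, ‖iteratedFDeriv ℝ i f x‖ ≤ R := by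
    obtain ⟨R, hR⟩ := (hf.continuous_iteratedFDeriv
      (m := i) (mod_cast le_top)).norm.bddAbove_range_of_hasCompactSupport
        ((hc.iteratedFDeriv i).comp_left norm_zero)
    exact ⟨R, fun x => hR (mem_range_self x)⟩
  choose R hR using bound
  refine ⟨1 + ∑ i ∈ Finset.range (n + 1), |R i|, by positivity, fun i hi x => ?_⟩
  have := Finset.single_le_sum (f := fun i => |R i|) (fun i _ => abs_nonneg (R i))
    (Finset.mem_range.2 (Nat.lt_succ_of_le hi))
  linarith [hR i x, le_abs_self (R i)]

/-- A sequence of smooth compactly supported functions can be rescaled by positive constants so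
that its sum converges to a smooth function. -/
theorem exists_pos_contDiff_hasSum_smul {E F : Type*}
    [NormedAddCommGroup E] [NormedSpace ℝ E] [NormedAddCommGroup F] [NormedSpace ℝ F]
    [CompleteSpace F] {f : ℕ → E → F} (hf : ∀ n, ContDiff ℝ ∞ (f n))
    (hc : ∀ n, HasCompactSupport (f n)) :
    ∃ (c : ℕ → ℝ) (S : E → F), (∀ n, 0 < c n) ∧ ContDiff ℝ ∞ S ∧
      ∀ x, HasSum (fun n => c n • f n x) (S x) := by
  choose M hM hfM using fun n =>
    exists_norm_iteratedFDeriv_le_of_hasCompactSupport (hf n) (hc n) n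
  let c (n : ℕ) : ℝ := (1 / 2) ^ n / M n
  have hcpos (n : ℕ) : 0 < c n := div_pos (by positivity) (hM n)
  have bound (n i : ℕ) (hi : i ≤ n) (x : E) :
      ‖iteratedFDeriv ℝ i (c n • f n) x‖ ≤ (1 / 2) ^ n := by
    rw [iteratedFDeriv_const_smul_apply ((hf n).contDiffAt.of_le (mod_cast le_top)), norm_smul,
      Real.norm_of_nonneg (hcpos n).le]
    calc c n * ‖iteratedFDeriv ℝ i (f n) x‖ ≤ c n * M n := by
          gcongr
          · exact (hcpos n).le
          · exact hfM n i hi x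
      _ = (1 / 2) ^ n := div_mul_cancel₀ _ (hM n).ne'
  refine ⟨c, fun x => ∑' n, (c n • f n) x, hcpos, ?_, fun x => ?_⟩
  · refine contDiff_tsum_of_eventually (v := fun _ n => (1 / 2) ^ n)
      (fun n => (hf n).const_smul (c n)) (fun _ _ => summable_geometric_two) fun i _ => ?_
    rw [Nat.cofinite_eq_atTop]
    filter_upwards [Filter.eventually_ge_atTop i] with n hn x using bound n i hn x
  · refine (Summable.of_norm_bounded summable_geometric_two fun n => ?_).hasSum
    simpa only [norm_iteratedFDeriv_zero, Pi.smul_apply] using bound n 0 n.zero_le x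

/-- The product of a function smooth on an open set with a smooth function whose closed support
lies in that set is smooth. -/
theorem ContDiff.mul_of_tsupport_subset {E : Type*} [NormedAddCommGroup E] [NormedSpace ℝ E]
    {f k : E → ℝ} {U : Set E} (hf : ContDiff ℝ ∞ f) (hU : IsOpen U) (hk : ContDiffOn ℝ ∞ k U)
    (hfU : tsupport f ⊆ U) : ContDiff ℝ ∞ fun x => f x * k x := by
  refine contDiff_iff_contDiffAt.2 fun x => ?_
  by_cases hx : x ∈ tsupport f
  · exact hf.contDiffAt.mul (hk.contDiffAt (hU.mem_nhds (hfU hx)))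
  · refine (contDiffAt_const (c := (0 : ℝ))).congr_of_eventuallyEq ?_
    filter_upwards [notMem_tsupport_iff_eventuallyEq.1 hx] with y hy
    simp [hy]

/-- The strip `(-1,1) × ℝ` is the union of the supports of a sequence of nonnegative, invariant,
smooth functions with compact support in it. -/
theorem exists_invariant_bumps_strip :
    ∃ f : ℕ → ℝ × ℝ → ℝ, (∀ n, ContDiff ℝ ∞ (f n)) ∧ (∀ n, HasCompactSupport (f n)) ∧
      (∀ n, tsupport (f n) ⊆ Ioo (-1 : ℝ) 1 ×ˢ univ) ∧ (∀ n x, f n (-x) = f n x) ∧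
      (∀ n x, 0 ≤ f n x) ∧ ∀ x ∈ Ioo (-1 : ℝ) 1 ×ˢ univ, ∃ n, 0 < f n x := by
  let a (n : ℕ) : ContDiffBump (0 : ℝ) :=
    ⟨1 - 1 / (n + 2), 1 - 1 / (n + 3),
      sub_pos.2 ((div_lt_one (by positivity)).2 (by linarith [n.cast_nonneg (α := ℝ)])),
      sub_lt_sub_left (one_div_lt_one_div_of_lt (by positivity) (by linarith)) _⟩
  let b (n : ℕ) : ContDiffBump (0 : ℝ) := ⟨n + 1, n + 2, by positivity, by linarith⟩
  have hsupp (n : ℕ) : tsupport (fun x : ℝ × ℝ => a n x.1 * b n x.2) ⊆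
      closedBall 0 (a n).rOut ×ˢ closedBall 0 (b n).rOut := by
    refine closure_minimal (fun x hx => ?_) (isClosed_closedBall.prod isClosed_closedBall)
    rw [mem_support, mul_ne_zero_iff] at hx
    rw [← (a n).tsupport_eq, ← (b n).tsupport_eq]
    exact ⟨subset_tsupport _ hx.1, subset_tsupport _ hx.2⟩
  refine ⟨fun n x => a n x.1 * b n x.2,
    fun n => ((a n).contDiff.comp contDiff_fst).mul ((b n).contDiff.comp contDiff_snd),
    fun n => ((isCompact_closedBall _ _).prod (isCompact_closedBall _ _)).of_isClosed_subset
      (isClosed_tsupport _) (hsupp n), fun n x hx => ⟨?_, mem_univ _⟩, fun n x => ?_,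
    fun n x => mul_nonneg (a n).nonneg (b n).nonneg, fun x hx => ?_⟩
  · have hx1 : |x.1| ≤ 1 - 1 / ((n : ℝ) + 3) := by
      simpa [a, Real.norm_eq_abs] using (hsupp n hx).1
    have : 0 < 1 / ((n : ℝ) + 3) := by positivity
    exact abs_lt.1 (by linarith)
  · simp [ContDiffBump.neg]
  · have hx1 : |x.1| < 1 := abs_lt.2 hx.1
    obtain ⟨m, hm⟩ := exists_nat_one_div_lt (sub_pos.2 hx1)
    obtain ⟨l, hl⟩ := exists_nat_gt |x.2|
    refine ⟨max m l, mul_pos ((a _).pos_of_mem_ball ?_) ((b _).pos_of_mem_ball ?_)⟩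
    · have hml : (m : ℝ) ≤ (max m l : ℕ) := mod_cast le_max_left m l
      have : 1 / (((max m l : ℕ) : ℝ) + 3) ≤ 1 / ((m : ℝ) + 1) :=
        one_div_le_one_div_of_le (by positivity) (by linarith)
      rw [mem_ball_zero_iff, Real.norm_eq_abs]
      change |x.1| < 1 - 1 / (((max m l : ℕ) : ℝ) + 3)
      linarith
    · have hml : (l : ℝ) ≤ (max m l : ℕ) := mod_cast le_max_right m l
      rw [mem_ball_zero_iff, Real.norm_eq_abs]
      change |x.2| < ((max m l : ℕ) : ℝ) + 2
      linarith


/-- Any smooth `ℤ/2`-invariant function `k` on the invariant open strip `(-1,1) × ℝ ⊆ ℝ²`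
(the involution being `(u,p) ↦ (-u,-p)`) can be written as a quotient `k = g/h` of two
globally defined smooth invariant functions, where `h` does not vanish on the strip. -/
theorem invariant_localization (k : ℝ × ℝ → ℝ)
    (hk : ContDiffOn ℝ (⊤ : ℕ∞) k (Set.Ioo (-1 : ℝ) 1 ×ˢ (Set.univ : Set ℝ)))
    (hkinv : ∀ u p : ℝ, u ∈ Set.Ioo (-1 : ℝ) 1 → k (-u, -p) = k (u, p)) :
    ∃ g h : ℝ × ℝ → ℝ,
      ContDiff ℝ (⊤ : ℕ∞) g ∧ ContDiff ℝ (⊤ : ℕ∞) h ∧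
      (∀ u p : ℝ, g (-u, -p) = g (u, p)) ∧
      (∀ u p : ℝ, h (-u, -p) = h (u, p)) ∧
      (∀ u p : ℝ, u ∈ Set.Ioo (-1 : ℝ) 1 →
        h (u, p) ≠ 0 ∧ h (u, p) * k (u, p) = g (u, p)) := by
  obtain ⟨f, hf, hfc, hfU, hfinv, hf0, hfpos⟩ := exists_invariant_bumps_strip
  have hU : IsOpen (Ioo (-1 : ℝ) 1 ×ˢ (univ : Set ℝ)) := isOpen_Ioo.prod isOpen_univ
  obtain ⟨c, S, hc, hS, hsum⟩ := exists_pos_contDiff_hasSum_smul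
    (f := fun n x => (f n x, f n x * k x))
    (fun n => (hf n).prodMk ((hf n).mul_of_tsupport_subset hU hk (hfU n)))
    (fun n => (hfc n).mono fun x hx h0 => hx (by simp [h0]))
  have hterm (n : ℕ) (u p : ℝ) : f n (-u, -p) * k (-u, -p) = f n (u, p) * k (u, p) := by
    have hneg : f n (-u, -p) = f n (u, p) := hfinv n (u, p)
    rw [hneg]
    by_cases hu : u ∈ Ioo (-1 : ℝ) 1
    · rw [hkinv u p hu]
    · rw [image_eq_zero_of_notMem_tsupport fun h => hu (hfU n h).1, zero_mul, zero_mul]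
  have hSinv (u p : ℝ) : S (-u, -p) = S (u, p) := by
    refine (hsum (-u, -p)).unique ?_
    convert hsum (u, p) using 4 with n
    · exact hfinv n (u, p)
    · exact hterm n u p
  have hfst (x : ℝ × ℝ) : HasSum (fun n => c n * f n x) (S x).1 :=
    (hsum x).map (AddMonoidHom.fst ℝ ℝ) continuous_fst
  have hsnd (x : ℝ × ℝ) : HasSum (fun n => c n * (f n x * k x)) (S x).2 :=
    (hsum x).map (AddMonoidHom.snd ℝ ℝ) continuous_snd
  refine ⟨fun x => (S x).2, fun x => (S x).1, contDiff_snd.comp hS, contDiff_fst.comp hS,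
    fun u p => by simp only [hSinv], fun u p => by simp only [hSinv], fun u p hu => ⟨?_, ?_⟩⟩
  · obtain ⟨n, hn⟩ := hfpos (u, p) ⟨hu, mem_univ _⟩
    exact ((mul_pos (hc n) hn).trans_le
      (le_hasSum (hfst _) n fun m _ => mul_nonneg (hc m).le (hf0 m _))).ne'
  · refine HasSum.unique ?_ (hsnd (u, p))
    simpa only [mul_assoc] using (hfst (u, p)).mul_right (k (u, p))
end
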